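/- arXiv:1804.01960 — 4 statements merged into one kernel-verified Lean document; each statement's English description precedes it below -/
import Mathlib

section
/- Let f : ℝ^N → ℝ be smooth with ∇²f(v,v) ≥ 0 for all vectors v, and fix x₀ ∈ ℝ^N. Then every smooth (not necessarily positive) ancient solution u of the weighted heat equation ∂ₜu = Δ_f u on ℝ^N × (−∞, 0] satisfying |u(x,t)| = o(|x−x₀|^{1/2} + |t|^{1/4}) near infinity is constant. -/
open Real Set Metric Filter
open scoped RealInnerProductSpace Topology

noncomputable section

/-- The Hessian of `f : ℝ^N → ℝ` at `x`, evaluated on the pair of vectors `(v, w)`. -/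
def hess {N : ℕ} (f : EuclideanSpace ℝ (Fin N) → ℝ) (x v w : EuclideanSpace ℝ (Fin N)) : ℝ :=
  ⟪fderiv ℝ (gradient f) x v, w⟫

/-- The Laplacian of `f : ℝ^N → ℝ` at `x` (trace of the Hessian). -/
def lap {N : ℕ} (f : EuclideanSpace ℝ (Fin N) → ℝ) (x : EuclideanSpace ℝ (Fin N)) : ℝ :=
  ∑ i, hess f x (EuclideanSpace.single i 1) (EuclideanSpace.single i 1)

/-- The weighted (drift) Laplacian `Δ_f u = Δ u − ⟨∇f, ∇u⟩`. -/
def wlap {N : ℕ} (f u : EuclideanSpace ℝ (Fin N) → ℝ) (x : EuclideanSpace ℝ (Fin N)) : ℝ :=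
  lap u x - ⟪gradient f x, gradient u x⟫

/-- Spatial gradient of a space-time function. -/
def sgrad {N : ℕ} (u : EuclideanSpace ℝ (Fin N) × ℝ → ℝ) (p : EuclideanSpace ℝ (Fin N) × ℝ) :
    EuclideanSpace ℝ (Fin N) :=
  gradient (fun y => u (y, p.2)) p.1

/-- Spatial weighted Laplacian `Δ_f u(·,t)` of a space-time function. -/
def swlap {N : ℕ} (f : EuclideanSpace ℝ (Fin N) → ℝ) (u : EuclideanSpace ℝ (Fin N) × ℝ → ℝ)
    (p : EuclideanSpace ℝ (Fin N) × ℝ) : ℝ :=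
  wlap f (fun y => u (y, p.2)) p.1

/-- Time derivative `∂ₜ u` of a space-time function. -/
def tderiv {N : ℕ} (u : EuclideanSpace ℝ (Fin N) × ℝ → ℝ) (p : EuclideanSpace ℝ (Fin N) × ℝ) : ℝ :=
  deriv (fun s => u (p.1, s)) p.2

/-- The parabolic cylinder `Q_{R,T} = B̄(x₀,R) × [t₀ − T, t₀]`. -/
def cyl {N : ℕ} (x₀ : EuclideanSpace ℝ (Fin N)) (R t₀ T : ℝ) :
    Set (EuclideanSpace ℝ (Fin N) × ℝ) :=
  (closedBall x₀ R) ×ˢ (Icc (t₀ - T) t₀)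

/-- `μ := max_{|x−x₀|=1} ((N−1) − ⟨∇f(x), x−x₀⟩)`. -/
def muConst {N : ℕ} (f : EuclideanSpace ℝ (Fin N) → ℝ) (x₀ : EuclideanSpace ℝ (Fin N)) : ℝ :=
  sSup ((fun x => ((N : ℝ) - 1) - ⟪gradient f x, x - x₀⟫) '' sphere x₀ 1)

/-- The "near infinity" filter on space-time `ℝ^N × (−∞,0]`: `|x − x₀| + |t| → ∞`
within the region `t ≤ 0`. -/
def ancientAtInfty {N : ℕ} (x₀ : EuclideanSpace ℝ (Fin N)) :
    Filter (EuclideanSpace ℝ (Fin N) × ℝ) :=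
  (Filter.comap (fun p => ‖p.1 - x₀‖ + |p.2|) Filter.atTop) ⊓ 𝓟 {p | p.2 ≤ 0}

section helpers

variable {V : Type*} [NormedAddCommGroup V] [NormedSpace ℝ V]

/-- Directional derivative. -/
def dd (v : V) (h : V → ℝ) (p : V) : ℝ := fderiv ℝ h p v

lemma dd_contDiff {h : V → ℝ} (hh : ContDiff ℝ (⊤ : ℕ∞) h) (v : V) :
    ContDiff ℝ (⊤ : ℕ∞) (dd v h) := by
  have h1 : ContDiff ℝ (⊤ : ℕ∞) (fderiv ℝ h) := hh.fderiv_right (by simp)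
  exact h1.clm_apply contDiff_const

lemma sm_diff {h : V → ℝ} (hh : ContDiff ℝ (⊤ : ℕ∞) h) : Differentiable ℝ h :=
  hh.differentiable (by simp)

lemma dd_comm {h : V → ℝ} (hh : ContDiff ℝ (⊤ : ℕ∞) h) (v w : V) (p : V) :
    dd v (dd w h) p = dd w (dd v h) p := by
  have h1 : ContDiff ℝ (⊤ : ℕ∞) (fderiv ℝ h) := hh.fderiv_right (by simp)
  have h2 : Differentiable ℝ (fderiv ℝ h) := h1.differentiable (by simp)
  have key : ∀ a b : V, dd a (dd b h) p = fderiv ℝ (fderiv ℝ h) p a b := by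
    intro a b
    unfold dd
    rw [fderiv_clm_apply (h2 p) (by fun_prop)]
    simp
  rw [key, key]
  have := (hh.contDiffAt (x := p)).isSymmSndFDerivAt (by
    rw [minSmoothness_of_isRCLikeNormedField]
    exact WithTop.coe_le_coe.2 (le_top : (2 : ℕ∞) ≤ ⊤))
  exact this v w

lemma dd_mul {a b : V → ℝ} (ha : ContDiff ℝ (⊤ : ℕ∞) a) (hb : ContDiff ℝ (⊤ : ℕ∞) b) (v p : V) :
    dd v (fun q => a q * b q) p = a p * dd v b p + b p * dd v a p := by
  unfold dd
  rw [fderiv_fun_mul (sm_diff ha p) (sm_diff hb p)]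
  simp

lemma dd_add {a b : V → ℝ} (ha : ContDiff ℝ (⊤ : ℕ∞) a) (hb : ContDiff ℝ (⊤ : ℕ∞) b) (v p : V) :
    dd v (fun q => a q + b q) p = dd v a p + dd v b p := by
  unfold dd
  rw [fderiv_fun_add (sm_diff ha p) (sm_diff hb p)]
  simp

lemma dd_sub {a b : V → ℝ} (ha : ContDiff ℝ (⊤ : ℕ∞) a) (hb : ContDiff ℝ (⊤ : ℕ∞) b) (v p : V) :
    dd v (fun q => a q - b q) p = dd v a p - dd v b p := by
  unfold dd
  rw [fderiv_fun_sub (sm_diff ha p) (sm_diff hb p)]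
  simp

lemma dd_lin {ι : Type*} (s : Finset ι) (c : ι → ℝ) (w : ι → V) (h : V → ℝ) (p : V) :
    dd (∑ i ∈ s, c i • w i) h p = ∑ i ∈ s, c i * dd (w i) h p := by
  unfold dd
  simp

lemma dd_const_mul {b : V → ℝ} (hb : ContDiff ℝ (⊤ : ℕ∞) b) (c : ℝ) (v p : V) :
    dd v (fun q => c * b q) p = c * dd v b p := by
  unfold dd
  rw [fderiv_const_mul (sm_diff hb p)]
  simp

lemma dd_sum {ι : Type*} (s : Finset ι) {a : ι → V → ℝ} (ha : ∀ i, ContDiff ℝ (⊤ : ℕ∞) (a i)) (v p : V) :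
    dd v (fun q => ∑ i ∈ s, a i q) p = ∑ i ∈ s, dd v (a i) p := by
  unfold dd
  rw [fderiv_fun_sum (fun i _ => sm_diff (ha i) p)]
  simp

lemma dd_line {h : V → ℝ} (hh : ContDiff ℝ (⊤ : ℕ∞) h) (v p : V) (s : ℝ) :
    HasDerivAt (fun s : ℝ => h (p + s • v)) (dd v h (p + s • v)) s := by
  have h1 : HasDerivAt (fun s : ℝ => p + s • v) v s := by
    simpa using ((hasDerivAt_id s).smul_const v).const_add p
  exact (sm_diff hh _).hasFDerivAt.comp_hasDerivAt s h1

lemma dd_zero_of_line {h : V → ℝ} (hh : ContDiff ℝ (⊤ : ℕ∞) h) (v p : V)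
    (hz : ∀ s : ℝ, h (p + s • v) = 0) : dd v h p = 0 := by
  have h1 := dd_line hh v p 0
  have h2 : (fun s : ℝ => h (p + s • v)) = fun _ => 0 := funext hz
  rw [h2] at h1
  have := h1.unique (hasDerivAt_const 0 0)
  simpa using this

/-- Necessary conditions at a line-wise local maximum. -/
lemma dd_max {h : V → ℝ} (hh : ContDiff ℝ (⊤ : ℕ∞) h) (v p : V)
    (hm : ∀ᶠ s in 𝓝 (0 : ℝ), h (p + s • v) ≤ h p) :
    dd v h p = 0 ∧ dd v (dd v h) p ≤ 0 := by
  set k : ℝ → ℝ := fun s => h (p + s • v) with hk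
  have hk1 : ∀ s, HasDerivAt k (dd v h (p + s • v)) s := fun s => dd_line hh v p s
  have hk2 : ∀ s, HasDerivAt (fun s : ℝ => dd v h (p + s • v)) (dd v (dd v h) (p + s • v)) s :=
    fun s => dd_line (dd_contDiff hh v) v p s
  have hmax : IsLocalMax k 0 := by
    filter_upwards [hm] with s hs
    simpa [hk] using hs
  have hd : deriv k = fun s => dd v h (p + s • v) := funext fun s => (hk1 s).deriv
  have h0 : deriv k 0 = 0 := hmax.deriv_eq_zero
  have hdd : deriv (deriv k) 0 = dd v (dd v h) p := by
    rw [hd, (hk2 0).deriv]; simp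
  refine ⟨by simpa [hd] using h0, ?_⟩
  by_contra hcon
  push Not at hcon
  have hmin : IsLocalMin k 0 := isLocalMin_of_deriv_deriv_pos (by rw [hdd]; exact hcon) h0 (hk1 0).continuousAt
  have hconst : k =ᶠ[𝓝 0] fun _ => k 0 := by
    filter_upwards [hmax, hmin] with s h1 h2
    exact le_antisymm h1 h2
  have h3 : deriv k =ᶠ[𝓝 0] deriv (fun _ => k 0) := hconst.deriv
  have h4 := h3.deriv_eq
  rw [hdd] at h4
  simp at h4
  linarith

lemma dd_max_left {h : V → ℝ} (hh : ContDiff ℝ (⊤ : ℕ∞) h) (v p : V)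
    (hm : ∀ᶠ s in 𝓝[<] (0 : ℝ), h (p + s • v) ≤ h p) :
    0 ≤ dd v h p := by
  have h1 := dd_line hh v p 0
  simp only [zero_smul, add_zero] at h1
  have h2 := h1.hasDerivWithinAt (s := Iio 0)
  rw [hasDerivWithinAt_iff_tendsto_slope' (by simp)] at h2
  refine ge_of_tendsto h2 ?_
  filter_upwards [hm, self_mem_nhdsWithin] with s hs hs0
  simp only [slope_def_field, sub_zero, zero_smul, add_zero]
  exact div_nonneg_of_nonpos (by linarith) (le_of_lt hs0)

/-- The weighted heat operator `∂_t - Δ + ⟨∇g, ∇·⟩`. -/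
def heatL {N : ℕ} (e : Fin N → V) (τ : V) (g h : V → ℝ) (p : V) : ℝ :=
  dd τ h p - ∑ i, dd (e i) (dd (e i) h) p + ∑ i, dd (e i) g p * dd (e i) h p

variable {N : ℕ} (e : Fin N → V) (τ : V) (g : V → ℝ)

lemma heatL_add {a b : V → ℝ} (ha : ContDiff ℝ (⊤ : ℕ∞) a) (hb : ContDiff ℝ (⊤ : ℕ∞) b) (p : V) :
    heatL e τ g (fun q => a q + b q) p = heatL e τ g a p + heatL e τ g b p := by
  unfold heatL
  have h1 : ∀ i, dd (e i) (fun q => a q + b q) = fun q => dd (e i) a q + dd (e i) b q :=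
    fun i => funext fun q => dd_add ha hb _ _
  simp only [h1, dd_add ha hb, dd_add (dd_contDiff ha _) (dd_contDiff hb _), Finset.sum_add_distrib, mul_add]
  ring

lemma heatL_sum {ι : Type*} (s : Finset ι) {a : ι → V → ℝ} (ha : ∀ i, ContDiff ℝ (⊤ : ℕ∞) (a i)) (p : V) :
    heatL e τ g (fun q => ∑ i ∈ s, a i q) p = ∑ i ∈ s, heatL e τ g (a i) p := by
  classical
  induction s using Finset.induction_on with
  | empty => 
    have h1 : ∀ v : V, dd v (fun _ : V => (0:ℝ)) = fun _ => 0 := by intro v; funext q; simp [dd]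
    simp [heatL, h1]
  | insert i s hi ih =>
    simp only [Finset.sum_insert hi]
    rw [heatL_add e τ g (ha i) (ContDiff.sum fun j _ => ha j), ih]

lemma heatL_mul {a b : V → ℝ} (ha : ContDiff ℝ (⊤ : ℕ∞) a) (hb : ContDiff ℝ (⊤ : ℕ∞) b) (p : V) :
    heatL e τ g (fun q => a q * b q) p =
      a p * heatL e τ g b p + b p * heatL e τ g a p - 2 * ∑ i, dd (e i) a p * dd (e i) b p := by
  unfold heatL
  have h1 : ∀ i, dd (e i) (fun q => a q * b q) = fun q => a q * dd (e i) b q + b q * dd (e i) a q :=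
    fun i => funext fun q => dd_mul ha hb _ _
  have h2 : ∀ i, dd (e i) (dd (e i) (fun q => a q * b q)) p
      = a p * dd (e i) (dd (e i) b) p + b p * dd (e i) (dd (e i) a) p + 2 * (dd (e i) a p * dd (e i) b p) := by
    intro i
    rw [h1, dd_add (ha.mul (dd_contDiff hb _)) (hb.mul (dd_contDiff ha _)), dd_mul ha (dd_contDiff hb _),
      dd_mul hb (dd_contDiff ha _)]
    ring
  simp only [h2, dd_mul ha hb, Finset.sum_add_distrib, mul_add, ← Finset.mul_sum]
  have h3 : ∀ c : ℝ, ∀ h : V → ℝ, ∑ i, dd (e i) g p * (c * dd (e i) h p) = c * ∑ i, dd (e i) g p * dd (e i) h p := by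
    intro c h
    rw [Finset.mul_sum]; exact Finset.sum_congr rfl fun i _ => by ring
  rw [h3, h3]
  ring

lemma heatL_contDiff (hg : ContDiff ℝ (⊤ : ℕ∞) g) {h : V → ℝ} (hh : ContDiff ℝ (⊤ : ℕ∞) h) :
    ContDiff ℝ (⊤ : ℕ∞) (heatL e τ g h) := by
  unfold heatL
  refine ((dd_contDiff hh _).sub (ContDiff.sum fun i _ => dd_contDiff (dd_contDiff hh _) _)).add
    (ContDiff.sum fun i _ => (dd_contDiff hg _).mul (dd_contDiff hh _))

/-- Commutator of `heatL` with a directional derivative. -/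
lemma heatL_dd (hg : ContDiff ℝ (⊤ : ℕ∞) g) {h : V → ℝ} (hh : ContDiff ℝ (⊤ : ℕ∞) h) (v p : V) :
    heatL e τ g (dd v h) p = dd v (heatL e τ g h) p - ∑ i, dd v (dd (e i) g) p * dd (e i) h p := by
  have hc : ∀ w, dd w (dd v h) = dd v (dd w h) := fun w => funext fun q => dd_comm hh _ _ _
  have hA := dd_contDiff hh τ
  have hB : ∀ i, ContDiff ℝ (⊤ : ℕ∞) (dd (e i) (dd (e i) h)) := fun i => dd_contDiff (dd_contDiff hh _) _
  have hC : ∀ i, ContDiff ℝ (⊤ : ℕ∞) (fun q => dd (e i) g q * dd (e i) h q) :=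
    fun i => (dd_contDiff hg _).mul (dd_contDiff hh _)
  have e1 : dd v (heatL e τ g h) p = dd v (dd τ h) p - ∑ i, dd v (dd (e i) (dd (e i) h)) p
      + ∑ i, dd v (fun q => dd (e i) g q * dd (e i) h q) p := by
    rw [← dd_sum _ hB, ← dd_sum _ hC]
    have : dd v (heatL e τ g h) p = dd v (fun q => (dd τ h q - ∑ i, dd (e i) (dd (e i) h) q)
      + ∑ i, dd (e i) g q * dd (e i) h q) p := rfl
    rw [this, dd_add (hA.sub (ContDiff.sum fun i _ => hB i)) (ContDiff.sum fun i _ => hC i)]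
    congr 1
    exact dd_sub hA (ContDiff.sum fun i _ => hB i) _ _
  rw [e1]
  unfold heatL
  simp only [hc]
  have e2 : ∀ i, dd (e i) (dd v (dd (e i) h)) p = dd v (dd (e i) (dd (e i) h)) p :=
    fun i => dd_comm (dd_contDiff hh _) _ _ _
  simp only [e2, dd_mul (dd_contDiff hg _) (dd_contDiff hh _), Finset.sum_add_distrib]
  have e3 : ∑ i, dd (e i) h p * dd v (dd (e i) g) p = ∑ i, dd v (dd (e i) g) p * dd (e i) h p :=
    Finset.sum_congr rfl fun i _ => mul_comm _ _
  rw [e3]; ring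

/-- Squared gradient. -/
def gsq (h : V → ℝ) (p : V) : ℝ := ∑ j, dd (e j) h p * dd (e j) h p

lemma gsq_contDiff {h : V → ℝ} (hh : ContDiff ℝ (⊤ : ℕ∞) h) : ContDiff ℝ (⊤ : ℕ∞) (gsq e h) :=
  ContDiff.sum fun j _ => (dd_contDiff hh _).mul (dd_contDiff hh _)

/-- Bernstein-type inequality. -/
lemma bernstein_ineq (hg : ContDiff ℝ (⊤ : ℕ∞) g) {u φ : V → ℝ} (hu : ContDiff ℝ (⊤ : ℕ∞) u)
    (hφ : ContDiff ℝ (⊤ : ℕ∞) φ) (A : ℝ) (p : V)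
    (hLu : heatL e τ g u p = 0) (hLu' : ∀ j, dd (e j) (heatL e τ g u) p = 0)
    (hconv : ∀ a : Fin N → ℝ, 0 ≤ ∑ j, ∑ i, a j * a i * dd (e j) (dd (e i) g) p) :
    heatL e τ g (fun q => (φ q * φ q) * gsq e u q + A * (u q * u q)) p ≤
      gsq e u p * (2 * φ p * heatL e τ g φ p + 6 * gsq e φ p - 2 * A) := by
  have hw := gsq_contDiff e hu
  have cA : ContDiff ℝ (⊤ : ℕ∞) (fun _ : V => A) := contDiff_const
  have zA : ∀ v : V, dd v (fun _ : V => A) = fun _ => 0 := by intro v; funext q; simp [dd]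
  have zz : ∀ v : V, dd v (fun _ : V => (0 : ℝ)) = fun _ => 0 := by intro v; funext q; simp [dd]
  have LA : heatL e τ g (fun _ : V => A) p = 0 := by simp [heatL, zA, zz]
  rw [heatL_add e τ g ((hφ.mul hφ).mul hw) (cA.mul (hu.mul hu)), heatL_mul e τ g (hφ.mul hφ) hw,
    heatL_mul e τ g cA (hu.mul hu), heatL_mul e τ g hu hu, heatL_mul e τ g hφ hφ, LA, hLu]
  simp only [zA, zero_mul, Finset.sum_const_zero, dd_mul hφ hφ]
  set S := ∑ j, ∑ i, dd (e i) (dd (e j) u) p * dd (e i) (dd (e j) u) p with hS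
  have hLw : heatL e τ g (gsq e u) p ≤ - 2 * S := by
    have h1 : heatL e τ g (gsq e u) p = ∑ j, heatL e τ g (fun q => dd (e j) u q * dd (e j) u q) p :=
      heatL_sum e τ g _ (fun j => (dd_contDiff hu _).mul (dd_contDiff hu _)) p
    rw [h1]
    have h2 : ∀ j, heatL e τ g (fun q => dd (e j) u q * dd (e j) u q) p =
       -2 * (∑ i, dd (e j) u p * dd (e i) u p * dd (e j) (dd (e i) g) p)
         - 2 * ∑ i, dd (e i) (dd (e j) u) p * dd (e i) (dd (e j) u) p := by
      intro j
      rw [heatL_mul e τ g (dd_contDiff hu _) (dd_contDiff hu _), heatL_dd e τ g hg hu, hLu']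
      have : ∑ i, dd (e j) u p * dd (e i) u p * dd (e j) (dd (e i) g) p
        = dd (e j) u p * ∑ i, dd (e j) (dd (e i) g) p * dd (e i) u p := by
        rw [Finset.mul_sum]; exact Finset.sum_congr rfl fun i _ => by ring
      rw [this]; ring
    simp only [h2, Finset.sum_sub_distrib, ← Finset.mul_sum]
    have := hconv (fun j => dd (e j) u p)
    linarith
  have hcross : - 2 * ∑ i, (φ p * dd (e i) φ p + φ p * dd (e i) φ p) * dd (e i) (gsq e u) p
      ≤ 2 * (φ p * φ p) * S + 8 * (gsq e φ p * gsq e u p) := by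
    have h1 : ∀ i, dd (e i) (gsq e u) p = ∑ j, 2 * (dd (e j) u p * dd (e i) (dd (e j) u) p) := by
      intro i
      have := dd_sum Finset.univ (fun j => (dd_contDiff hu (e j)).mul (dd_contDiff hu (e j))) (e i) p
      refine this.trans (Finset.sum_congr rfl fun j _ => ?_)
      rw [dd_mul (dd_contDiff hu _) (dd_contDiff hu _)]; ring
    have h2 : gsq e φ p * gsq e u p = ∑ i, ∑ j, (dd (e i) φ p * dd (e i) φ p) * (dd (e j) u p * dd (e j) u p) := by
      unfold gsq; rw [Finset.sum_mul_sum]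
    rw [h2, hS, Finset.sum_comm]
    simp only [h1, Finset.mul_sum, ← Finset.sum_add_distrib]
    refine Finset.sum_le_sum fun i _ => Finset.sum_le_sum fun j _ => ?_
    nlinarith [sq_nonneg (φ p * dd (e i) (dd (e j) u) p + 2 * (dd (e i) φ p * dd (e j) u p))]
  have h3 := mul_le_mul_of_nonneg_left hLw (mul_self_nonneg (φ p))
  have h4 : ∑ i, dd (e i) u p * dd (e i) u p = gsq e u p := rfl
  have h5 : ∑ i, dd (e i) φ p * dd (e i) φ p = gsq e φ p := rfl
  rw [h4, h5]
  nlinarith [h3, hcross]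

/-- Sign of the operator at a (backward-in-time) maximum. -/
lemma heatL_max {h : V → ℝ} (hh : ContDiff ℝ (⊤ : ℕ∞) h) (p : V)
    (hs : ∀ i, ∀ᶠ s in 𝓝 (0 : ℝ), h (p + s • e i) ≤ h p)
    (ht : ∀ᶠ s in 𝓝[<] (0 : ℝ), h (p + s • τ) ≤ h p) : 0 ≤ heatL e τ g h p := by
  unfold heatL
  have h1 := fun i => (dd_max hh (e i) p (hs i)).1
  have h2 := Finset.sum_nonpos fun i (_ : i ∈ Finset.univ) => (dd_max hh (e i) p (hs i)).2
  have h3 := dd_max_left hh τ p ht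
  simp only [h1, mul_zero, Finset.sum_const_zero]
  linarith

end helpers

section spec

variable {N : ℕ}

/-- Spatial coordinate directions in space-time. -/
def ee (i : Fin N) : EuclideanSpace ℝ (Fin N) × ℝ := (EuclideanSpace.single i 1, 0)

/-- The time direction in space-time. -/
def tt : EuclideanSpace ℝ (Fin N) × ℝ := (0, 1)

lemma hess_eq {h : EuclideanSpace ℝ (Fin N) → ℝ} (hh : ContDiff ℝ (⊤ : ℕ∞) h)
    (x v w : EuclideanSpace ℝ (Fin N)) : hess h x v w = dd v (dd w h) x := by
  have h1 : ContDiff ℝ (⊤ : ℕ∞) (fderiv ℝ h) := hh.fderiv_right (by simp)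
  have h2 : Differentiable ℝ (gradient h) := by
    have : ContDiff ℝ (⊤ : ℕ∞) (gradient h) :=
      (InnerProductSpace.toDual ℝ (EuclideanSpace ℝ (Fin N))).symm.contDiff.comp h1
    exact this.differentiable (by simp)
  have h3 : dd w h = fun y => ⟪gradient h y, w⟫ := by
    funext y; rw [inner_gradient_left]; rfl
  unfold hess
  rw [h3]
  unfold dd
  rw [fderiv_inner_apply ℝ (h2 x) (by fun_prop)]
  simp

lemma dd_slice {u : EuclideanSpace ℝ (Fin N) × ℝ → ℝ} (hu : ContDiff ℝ (⊤ : ℕ∞) u)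
    (v x : EuclideanSpace ℝ (Fin N)) (t : ℝ) :
    dd v (fun y => u (y, t)) x = dd (v, (0 : ℝ)) u (x, t) := by
  have hs : ContDiff ℝ (⊤ : ℕ∞) (fun y => u (y, t)) := hu.comp (contDiff_id.prodMk contDiff_const)
  have h1 := dd_line hs v x 0
  have h2 := dd_line hu (v, (0 : ℝ)) (x, t) 0
  simp only [Prod.smul_mk, Prod.mk_add_mk, smul_zero, add_zero, zero_smul] at h1 h2
  exact h1.unique h2

lemma dd_slice2 {u : EuclideanSpace ℝ (Fin N) × ℝ → ℝ} (hu : ContDiff ℝ (⊤ : ℕ∞) u)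
    (v w x : EuclideanSpace ℝ (Fin N)) (t : ℝ) :
    dd v (dd w (fun y => u (y, t))) x = dd (v, (0 : ℝ)) (dd (w, (0 : ℝ)) u) (x, t) := by
  rw [← dd_slice (dd_contDiff hu _)]
  congr 1
  funext y
  exact dd_slice hu w y t

lemma inner_single (a : EuclideanSpace ℝ (Fin N)) (i : Fin N) :
    ⟪a, EuclideanSpace.single i (1 : ℝ)⟫ = a i := by
  rw [EuclideanSpace.inner_single_right]; simp

lemma inner_eq_sum (a b : EuclideanSpace ℝ (Fin N)) :
    ⟪a, b⟫ = ∑ i, ⟪a, EuclideanSpace.single i (1 : ℝ)⟫ * ⟪b, EuclideanSpace.single i (1 : ℝ)⟫ := by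
  rw [PiLp.inner_apply]
  refine Finset.sum_congr rfl fun i _ => ?_
  rw [inner_single, inner_single]; simp [mul_comm]

lemma sum_single (v : EuclideanSpace ℝ (Fin N)) :
    v = ∑ i, v i • EuclideanSpace.single i (1 : ℝ) := by
  ext j
  simp [Finset.sum_apply, Pi.single_apply]

lemma heq_iff {f : EuclideanSpace ℝ (Fin N) → ℝ} (hf : ContDiff ℝ (⊤ : ℕ∞) f)
    {u : EuclideanSpace ℝ (Fin N) × ℝ → ℝ} (hu : ContDiff ℝ (⊤ : ℕ∞) u)
    (p : EuclideanSpace ℝ (Fin N) × ℝ) (h : tderiv u p = swlap f u p) :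
    heatL ee tt (fun q => f q.1) u p = 0 := by
  obtain ⟨x, t⟩ := p
  have hg : ContDiff ℝ (⊤ : ℕ∞) (fun q : EuclideanSpace ℝ (Fin N) × ℝ => f q.1) := hf.comp contDiff_fst
  have hs : ContDiff ℝ (⊤ : ℕ∞) (fun y => u (y, t)) := hu.comp (contDiff_id.prodMk contDiff_const)
  have h1 : tderiv u (x, t) = dd tt u (x, t) := by
    unfold tderiv
    have h2 := dd_line hu tt (x, (0 : ℝ)) t
    simp only [tt, Prod.smul_mk, Prod.mk_add_mk, smul_zero, add_zero, zero_add, smul_eq_mul, mul_one] at h2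
    exact h2.deriv
  have h2 : swlap f u (x, t) = ∑ i, dd (ee i) (dd (ee i) u) (x, t)
      - ∑ i, dd (ee i) (fun q => f q.1) (x, t) * dd (ee i) u (x, t) := by
    unfold swlap wlap lap
    rw [inner_eq_sum]
    simp only [inner_gradient_left]
    congr 1
    · refine Finset.sum_congr rfl fun i _ => ?_
      rw [hess_eq hs]
      exact dd_slice2 hu _ _ _ _
    · refine Finset.sum_congr rfl fun i _ => ?_
      have e1 := dd_slice hu (EuclideanSpace.single i 1) x t
      have e2 := dd_slice hg (EuclideanSpace.single i 1) x t
      unfold ee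
      rw [← e1, ← e2]
      rfl
  unfold heatL
  rw [h1, h2] at h
  linarith

lemma hess_conv {f : EuclideanSpace ℝ (Fin N) → ℝ} (hf : ContDiff ℝ (⊤ : ℕ∞) f)
    (hRic : ∀ x v, (0 : ℝ) ≤ hess f x v v) (p : EuclideanSpace ℝ (Fin N) × ℝ) (a : Fin N → ℝ) :
    0 ≤ ∑ j, ∑ i, a j * a i * dd (ee j) (dd (ee i) (fun q => f q.1)) p := by
  obtain ⟨x, t⟩ := p
  have hg : ContDiff ℝ (⊤ : ℕ∞) (fun q : EuclideanSpace ℝ (Fin N) × ℝ => f q.1) := hf.comp contDiff_fst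
  have h := hRic x (∑ i, a i • EuclideanSpace.single i (1 : ℝ))
  rw [hess_eq hf, dd_lin] at h
  have e1 : dd (∑ i, a i • EuclideanSpace.single i (1 : ℝ)) f
      = fun y => ∑ i, a i * dd (EuclideanSpace.single i (1 : ℝ)) f y := funext fun y => dd_lin _ _ _ _ _
  rw [e1] at h
  refine h.trans_eq (Finset.sum_congr rfl fun j _ => ?_)
  rw [dd_sum _ (fun i => contDiff_const.mul (dd_contDiff hf _)), Finset.mul_sum]
  refine Finset.sum_congr rfl fun i _ => ?_
  rw [dd_const_mul (dd_contDiff hf _)]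
  have := dd_slice2 hg (EuclideanSpace.single j 1) (EuclideanSpace.single i 1) x t
  unfold ee
  rw [← this]
  ring

lemma grad_mono {f : EuclideanSpace ℝ (Fin N) → ℝ} (hf : ContDiff ℝ (⊤ : ℕ∞) f)
    (hRic : ∀ x v, (0 : ℝ) ≤ hess f x v v) (x₀ x : EuclideanSpace ℝ (Fin N)) :
    -(‖gradient f x₀‖ * ‖x - x₀‖) ≤ dd (x - x₀) f x := by
  set v := x - x₀ with hv
  have hm : Monotone (fun s : ℝ => dd v f (x₀ + s • v)) := by
    refine monotone_of_deriv_nonneg (fun s => (dd_line (dd_contDiff hf v) v x₀ s).differentiableAt) fun s => ?_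
    rw [(dd_line (dd_contDiff hf v) v x₀ s).deriv, ← hess_eq hf]
    exact hRic _ _
  have h1 := hm (zero_le_one (α := ℝ))
  simp only [zero_smul, add_zero, one_smul] at h1
  have h2 : x₀ + v = x := by simp [hv]
  rw [h2] at h1
  refine le_trans ?_ h1
  have h3 : dd v f x₀ = ⟪gradient f x₀, v⟫ := by rw [inner_gradient_left]; rfl
  rw [h3]
  exact (abs_le.1 (abs_real_inner_le_norm _ _)).1

/-- The cutoff. -/
def cut (x₀ : EuclideanSpace ℝ (Fin N)) (R : ℝ) (p : EuclideanSpace ℝ (Fin N) × ℝ) : ℝ :=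
  1 - ‖p.1 - x₀‖ ^ 2 / R ^ 2 + p.2 / R

lemma cut_contDiff (x₀ : EuclideanSpace ℝ (Fin N)) (R : ℝ) : ContDiff ℝ (⊤ : ℕ∞) (cut x₀ R) := by
  unfold cut
  have h : ContDiff ℝ (⊤ : ℕ∞) (fun p : EuclideanSpace ℝ (Fin N) × ℝ => ‖p.1 - x₀‖ ^ 2) :=
    (contDiff_fst.sub contDiff_const).norm_sq ℝ
  exact (contDiff_const.sub (h.div_const _)).add (contDiff_snd.div_const _)

lemma dd_cut (x₀ : EuclideanSpace ℝ (Fin N)) (R : ℝ) (v p : EuclideanSpace ℝ (Fin N) × ℝ) :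
    dd v (cut x₀ R) p = - 2 / R ^ 2 * ⟪p.1 - x₀, v.1⟫ + v.2 / R := by
  have h1 := dd_line (cut_contDiff x₀ R) v p 0
  simp only [zero_smul, add_zero] at h1
  have h2 : (fun s : ℝ => cut x₀ R (p + s • v)) = fun s =>
      cut x₀ R p + s * (- 2 / R ^ 2 * ⟪p.1 - x₀, v.1⟫ + v.2 / R) - s ^ 2 * (‖v.1‖ ^ 2 / R ^ 2) := by
    funext s
    unfold cut
    have : (p + s • v).1 - x₀ = (p.1 - x₀) + s • v.1 := by
      simp only [Prod.fst_add, Prod.smul_fst]; abel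
    rw [this, norm_add_sq_real, inner_smul_right, norm_smul, mul_pow, Real.norm_eq_abs, sq_abs]
    simp only [Prod.snd_add, Prod.smul_snd, smul_eq_mul]
    ring
  rw [h2] at h1
  have h3 : HasDerivAt (fun s : ℝ =>
      cut x₀ R p + s * (- 2 / R ^ 2 * ⟪p.1 - x₀, v.1⟫ + v.2 / R) - s ^ 2 * (‖v.1‖ ^ 2 / R ^ 2))
      (- 2 / R ^ 2 * ⟪p.1 - x₀, v.1⟫ + v.2 / R) 0 := by
    have := (((hasDerivAt_id (0 : ℝ)).mul_const (- 2 / R ^ 2 * ⟪p.1 - x₀, v.1⟫ + v.2 / R)).const_add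
      (cut x₀ R p)).sub ((hasDerivAt_pow 2 (0 : ℝ)).mul_const (‖v.1‖ ^ 2 / R ^ 2))
    exact this.congr_deriv (by simp)
  exact h1.unique h3

lemma gsq_cut (x₀ : EuclideanSpace ℝ (Fin N)) (R : ℝ) (p : EuclideanSpace ℝ (Fin N) × ℝ) :
    gsq ee (cut x₀ R) p = 4 * ‖p.1 - x₀‖ ^ 2 / R ^ 4 := by
  unfold gsq
  simp only [dd_cut, ee]
  have := inner_eq_sum (p.1 - x₀) (p.1 - x₀)
  rw [real_inner_self_eq_norm_sq] at this
  rw [this, Finset.mul_sum, Finset.sum_div]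
  refine Finset.sum_congr rfl fun i _ => ?_
  simp only [zero_div, add_zero]
  ring

lemma heatL_cut {f : EuclideanSpace ℝ (Fin N) → ℝ} (hf : ContDiff ℝ (⊤ : ℕ∞) f)
    (x₀ : EuclideanSpace ℝ (Fin N)) (R : ℝ) (p : EuclideanSpace ℝ (Fin N) × ℝ) :
    heatL ee tt (fun q => f q.1) (cut x₀ R) p = 1 / R + 2 * N / R ^ 2 - 2 / R ^ 2 * dd (p.1 - x₀) f p.1 := by
  have hg : ContDiff ℝ (⊤ : ℕ∞) (fun q : EuclideanSpace ℝ (Fin N) × ℝ => f q.1) := hf.comp contDiff_fst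
  unfold heatL
  have h1 : dd tt (cut x₀ R) p = 1 / R := by simp [dd_cut, tt]
  have h2 : ∀ i, dd (ee i) (cut x₀ R) = fun p => - 2 / R ^ 2 * (p.1 i - x₀ i) := by
    intro i; funext q; simp only [dd_cut, ee, inner_single]; simp
  have h3 : ∀ i, dd (ee i) (dd (ee i) (cut x₀ R)) p = - 2 / R ^ 2 := by
    intro i
    have h := dd_line (dd_contDiff (cut_contDiff x₀ R) (ee i)) (ee i) p 0
    simp only [zero_smul, add_zero] at h
    refine h.unique ?_
    rw [h2]
    have : (fun s : ℝ => - 2 / R ^ 2 * ((p + s • ee i).1 i - x₀ i)) = fun s => - 2 / R ^ 2 * (p.1 i - x₀ i) + s * (- 2 / R ^ 2) := by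
      funext s; simp [ee]; ring
    simp only [this]
    simpa using ((hasDerivAt_id (0 : ℝ)).mul_const (- 2 / R ^ 2)).const_add (- 2 / R ^ 2 * (p.1 i - x₀ i))
  have h4 : dd (p.1 - x₀) f p.1 = ∑ i, (p.1 - x₀) i * dd (EuclideanSpace.single i (1 : ℝ)) f p.1 := by
    conv_lhs => rw [sum_single (p.1 - x₀)]
    rw [dd_lin]
  have h5 : ∀ i, dd (ee i) (fun q => f q.1) p = dd (EuclideanSpace.single i (1 : ℝ)) f p.1 := by
    intro i
    exact (dd_slice hg (EuclideanSpace.single i 1) p.1 p.2).symm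
  have h6 : ∑ i, dd (ee i) (fun q => f q.1) p * dd (ee i) (cut x₀ R) p
      = - 2 / R ^ 2 * dd (p.1 - x₀) f p.1 := by
    rw [h4, Finset.mul_sum]
    refine Finset.sum_congr rfl fun i _ => ?_
    rw [h5, h2]
    simp only [PiLp.sub_apply]
    ring
  have h7 : ∑ i : Fin N, dd (ee i) (dd (ee i) (cut x₀ R)) p = N * (- 2 / R ^ 2) := by
    rw [Finset.sum_congr rfl fun i _ => h3 i]
    simp
  rw [h1, h6, h7]
  ring

/-- Local gradient estimate. -/
lemma local_est {f : EuclideanSpace ℝ (Fin N) → ℝ} (hf : ContDiff ℝ (⊤ : ℕ∞) f)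
    (hRic : ∀ x v, (0 : ℝ) ≤ hess f x v v) (x₀ : EuclideanSpace ℝ (Fin N))
    {u : EuclideanSpace ℝ (Fin N) × ℝ → ℝ} (hu : ContDiff ℝ (⊤ : ℕ∞) u)
    (hL : ∀ p : EuclideanSpace ℝ (Fin N) × ℝ, p.2 ≤ 0 → heatL ee tt (fun q => f q.1) u p = 0)
    (R : ℝ) (hR : 1 ≤ R) (B : ℝ)
    (hB : ∀ p : EuclideanSpace ℝ (Fin N) × ℝ, ‖p.1 - x₀‖ ≤ R → -R ≤ p.2 → p.2 ≤ 0 → u p * u p ≤ B)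
    (p : EuclideanSpace ℝ (Fin N) × ℝ) (hp : p.2 ≤ 0) (hpc : 0 ≤ cut x₀ R p) :
    cut x₀ R p * cut x₀ R p * gsq ee u p ≤ (2 * N + 2 * ‖gradient f x₀‖ + 14) / R * B := by
  set C := ‖gradient f x₀‖ with hC
  have hC0 : 0 ≤ C := norm_nonneg _
  set A := (2 * N + 2 * C + 14) / R with hA
  have hR0 : 0 < R := by linarith
  have hA0 : 0 < A := by positivity
  have hg : ContDiff ℝ (⊤ : ℕ∞) (fun q : EuclideanSpace ℝ (Fin N) × ℝ => f q.1) := hf.comp contDiff_fst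
  have hcut := cut_contDiff x₀ R
  set F : EuclideanSpace ℝ (Fin N) × ℝ → ℝ :=
    fun q => (cut x₀ R q * cut x₀ R q) * gsq ee u q + A * (u q * u q) with hF
  have hFs : ContDiff ℝ (⊤ : ℕ∞) F :=
    ((hcut.mul hcut).mul (gsq_contDiff ee hu)).add (contDiff_const.mul (hu.mul hu))
  set D : Set (EuclideanSpace ℝ (Fin N) × ℝ) := {q | q.2 ≤ 0 ∧ 0 ≤ cut x₀ R q} with hD
  have hDin : ∀ q ∈ D, ‖q.1 - x₀‖ ≤ R ∧ -R ≤ q.2 ∧ q.2 ≤ 0 ∧ cut x₀ R q ≤ 1 := by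
    rintro q ⟨h1, h2⟩
    have h3 : q.2 / R ≤ 0 := div_nonpos_of_nonpos_of_nonneg h1 hR0.le
    have h4 : 0 ≤ ‖q.1 - x₀‖ ^ 2 / R ^ 2 := by positivity
    unfold cut at h2 ⊢
    refine ⟨?_, ?_, h1, by linarith⟩
    · have : ‖q.1 - x₀‖ ^ 2 / R ^ 2 ≤ 1 := by linarith
      rw [div_le_one (by positivity)] at this
      exact le_of_sq_le_sq this hR0.le
    · have : -1 ≤ q.2 / R := by linarith
      rw [le_div_iff₀ hR0] at this
      linarith
  have hDc : IsCompact D := by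
    refine ((isCompact_closedBall x₀ R).prod (isCompact_Icc (a := -R) (b := 0))).of_isClosed_subset ?_ ?_
    · exact (isClosed_le continuous_snd continuous_const).inter (isClosed_le continuous_const hcut.continuous)
    · intro q hq
      obtain ⟨h1, h2, h3, -⟩ := hDin q hq
      exact ⟨by simpa [dist_eq_norm] using h1, h2, h3⟩
  obtain ⟨m, hm, hmax⟩ := hDc.exists_isMaxOn ⟨p, hp, hpc⟩ hFs.continuous.continuousOn
  obtain ⟨i1, i2, i3, i4⟩ := hDin m hm
  have hwn : ∀ q, 0 ≤ gsq ee u q := fun q => Finset.sum_nonneg fun j _ => mul_self_nonneg _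
  have hmB : F m ≤ A * B := by
    have hAB := mul_le_mul_of_nonneg_left (hB m i1 i2 i3) hA0.le
    by_cases hz : cut x₀ R m * cut x₀ R m * gsq ee u m = 0
    · simp only [hF, hz]; linarith
    exfalso
    have hcpos : 0 < cut x₀ R m := lt_of_le_of_ne hm.2 (fun h => hz (by rw [← h]; ring))
    have hwpos : 0 < gsq ee u m := lt_of_le_of_ne (hwn m) (fun h => hz (by rw [← h]; ring))
    have hev : ∀ v : EuclideanSpace ℝ (Fin N) × ℝ, ∀ᶠ s in 𝓝 (0 : ℝ), 0 ≤ cut x₀ R (m + s • v) := by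
      intro v
      have hcont : Continuous (fun s : ℝ => cut x₀ R (m + s • v)) := hcut.continuous.comp (by fun_prop)
      have : ∀ᶠ s in 𝓝 (0 : ℝ), 0 < cut x₀ R (m + s • v) :=
        hcont.continuousAt.eventually (lt_mem_nhds (by simpa using hcpos))
      exact this.mono fun s hs => hs.le
    have hge : 0 ≤ heatL ee tt (fun q => f q.1) F m := by
      refine heatL_max ee tt _ hFs m (fun i => ?_) ?_
      · filter_upwards [hev (ee i)] with s hs
        exact hmax (show m + s • ee i ∈ D from ⟨by simpa [ee] using i3, hs⟩)
      · filter_upwards [nhdsWithin_le_nhds (hev tt), self_mem_nhdsWithin] with s hs hs0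
        refine hmax (show m + s • tt ∈ D from ⟨?_, hs⟩)
        have hs1 : s < 0 := hs0
        simp [tt]; linarith
    have hle := bernstein_ineq ee tt (fun q : EuclideanSpace ℝ (Fin N) × ℝ => f q.1) hg hu hcut A m (hL m i3)
      (fun j => dd_zero_of_line (heatL_contDiff ee tt _ hg hu) _ _
        (fun s => hL _ (by simpa [ee] using i3))) (hess_conv hf hRic m)
    have hbr : 2 * cut x₀ R m * heatL ee tt (fun q => f q.1) (cut x₀ R) m
        + 6 * gsq ee (cut x₀ R) m - 2 * A < 0 := by
      have b1 : heatL ee tt (fun q => f q.1) (cut x₀ R) m ≤ (1 + 2 * N + 2 * C) / R := by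
        rw [heatL_cut hf]
        have g1 := grad_mono hf hRic x₀ m.1
        have g2 : - dd (m.1 - x₀) f m.1 ≤ C * R := by
          have := mul_le_mul_of_nonneg_left i1 hC0
          linarith
        have g3 : 2 / R ^ 2 * (- dd (m.1 - x₀) f m.1) ≤ 2 / R ^ 2 * (C * R) :=
          mul_le_mul_of_nonneg_left g2 (by positivity)
        have g4 : 2 / R ^ 2 * (C * R) = 2 * C / R := by field_simp
        have g5 : 2 * (N : ℝ) / R ^ 2 ≤ 2 * N / R := by
          apply div_le_div_of_nonneg_left (by positivity) hR0
          nlinarith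
        have g6 : (1 + 2 * (N : ℝ) + 2 * C) / R = 1 / R + 2 * N / R + 2 * C / R := by ring
        linarith
      have b2 : gsq ee (cut x₀ R) m ≤ 4 / R := by
        rw [gsq_cut, div_le_div_iff₀ (by positivity) hR0]
        have q1 : ‖m.1 - x₀‖ ^ 2 ≤ R ^ 2 := pow_le_pow_left₀ (norm_nonneg _) i1 2
        have q2 : R ^ 3 ≤ R ^ 4 := pow_le_pow_right₀ hR (by norm_num)
        have q3 := mul_le_mul_of_nonneg_right q1 hR0.le
        nlinarith
      have b3 : 2 * cut x₀ R m * heatL ee tt (fun q => f q.1) (cut x₀ R) m ≤ 2 * ((1 + 2 * N + 2 * C) / R) := by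
        have c1 := mul_le_mul_of_nonneg_left b1 (mul_nonneg zero_le_two hcpos.le)
        have c2 : 0 ≤ (1 + 2 * (N : ℝ) + 2 * C) / R := by positivity
        have c3 := mul_le_mul_of_nonneg_right i4 c2
        linarith
      have b4 : 2 * ((1 + 2 * (N : ℝ) + 2 * C) / R) + 6 * (4 / R) - 2 * A = - (2 / R) := by
        rw [hA]; ring
      have b5 : 0 < 2 / R := by positivity
      linarith
    have := mul_neg_of_pos_of_neg hwpos hbr
    linarith
  have hpm : F p ≤ F m := hmax (show p ∈ D from ⟨hp, hpc⟩)
  have : 0 ≤ A * (u p * u p) := mul_nonneg hA0.le (mul_self_nonneg _)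
  simp only [hF] at hpm hmB
  linarith

lemma growth_bound (x₀ : EuclideanSpace ℝ (Fin N))
    {u : EuclideanSpace ℝ (Fin N) × ℝ → ℝ} (hu : ContDiff ℝ (⊤ : ℕ∞) u)
    (hgrowth : Filter.Tendsto
      (fun p : EuclideanSpace ℝ (Fin N) × ℝ =>
        |u p| / (‖p.1 - x₀‖ ^ ((1 : ℝ) / 2) + |p.2| ^ ((1 : ℝ) / 4)))
      (ancientAtInfty x₀) (𝓝 0)) (ε : ℝ) (hε : 0 < ε) :
    ∀ᶠ R : ℝ in atTop, ∀ p : EuclideanSpace ℝ (Fin N) × ℝ, ‖p.1 - x₀‖ ≤ R → -R ≤ p.2 → p.2 ≤ 0 →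
      u p * u p ≤ 4 * ε ^ 2 * R := by
  have h1 := hgrowth.eventually (gt_mem_nhds hε)
  unfold ancientAtInfty at h1
  rw [eventually_inf_principal, eventually_comap] at h1
  obtain ⟨M, hM⟩ := (h1.and (eventually_ge_atTop 1)).exists_forall_of_atTop
  have hM1 : 1 ≤ M := (hM M le_rfl).2
  have hK : IsCompact (closedBall x₀ M ×ˢ Icc (-M) 0) :=
    (isCompact_closedBall x₀ M).prod isCompact_Icc
  obtain ⟨B, hB⟩ := hK.exists_bound_of_continuousOn (f := fun p => u p * u p)
    (hu.mul hu).continuous.continuousOn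
  filter_upwards [eventually_ge_atTop 1, eventually_ge_atTop (B / (4 * ε ^ 2))] with R hR1 hRB p hp1 hp2 hp3
  by_cases hc : M ≤ ‖p.1 - x₀‖ + |p.2|
  · have h2 := (hM _ hc).1 p rfl hp3
    have hsum : 0 < ‖p.1 - x₀‖ + |p.2| := by linarith
    have hr1 : ‖p.1 - x₀‖ ^ ((1 : ℝ) / 2) ≤ R ^ ((1 : ℝ) / 2) :=
      Real.rpow_le_rpow (norm_nonneg _) hp1 (by norm_num)
    have hr2 : |p.2| ^ ((1 : ℝ) / 4) ≤ R ^ ((1 : ℝ) / 2) := by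
      have : |p.2| ≤ R := by rw [abs_of_nonpos hp3]; linarith
      exact (Real.rpow_le_rpow (abs_nonneg _) this (by norm_num)).trans
        (Real.rpow_le_rpow_of_exponent_le hR1 (by norm_num))
    have hpos : 0 < ‖p.1 - x₀‖ ^ ((1 : ℝ) / 2) + |p.2| ^ ((1 : ℝ) / 4) := by
      rcases (norm_nonneg (p.1 - x₀)).eq_or_lt with h | h
      · have : 0 < |p.2| := by linarith
        have := Real.rpow_pos_of_pos this (1 / 4)
        have := Real.rpow_nonneg (norm_nonneg (p.1 - x₀)) (1 / 2)
        linarith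
      · have := Real.rpow_pos_of_pos h (1 / 2)
        have := Real.rpow_nonneg (abs_nonneg p.2) (1 / 4)
        linarith
    rw [div_lt_iff₀ hpos] at h2
    have h3 : |u p| ≤ ε * (2 * R ^ ((1 : ℝ) / 2)) :=
      h2.le.trans (mul_le_mul_of_nonneg_left (by linarith) hε.le)
    have h4 : R ^ ((1 : ℝ) / 2) * R ^ ((1 : ℝ) / 2) = R := by
      rw [← Real.rpow_add (by linarith)]; norm_num
    calc u p * u p = |u p| * |u p| := (abs_mul_abs_self _).symm
      _ ≤ (ε * (2 * R ^ ((1 : ℝ) / 2))) * (ε * (2 * R ^ ((1 : ℝ) / 2))) :=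
        mul_self_le_mul_self (abs_nonneg _) h3
      _ = 4 * ε ^ 2 * (R ^ ((1 : ℝ) / 2) * R ^ ((1 : ℝ) / 2)) := by ring
      _ = _ := by rw [h4]
  · push Not at hc
    have h2 := hB p ⟨by
      have := abs_nonneg p.2
      simp only [mem_closedBall, dist_eq_norm]; linarith, by
      have := norm_nonneg (p.1 - x₀)
      rw [abs_of_nonpos hp3] at hc
      linarith, hp3⟩
    have h3 : u p * u p ≤ B := (le_abs_self _).trans h2
    rw [div_le_iff₀ (by positivity)] at hRB
    linarith

end spec

/-- **Theorem 1.2(3), Euclidean case.** Every (not necessarily positive) ancient solution of the weighted heat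
equation `∂ₜ u = Δ_f u` with `|u(x,t)| = o(|x−x₀|^{1/2} + |t|^{1/4})` near infinity is constant. -/
theorem liouville_ancient_weighted_heat (N : ℕ)
    (f : EuclideanSpace ℝ (Fin N) → ℝ) (hf : ContDiff ℝ (⊤ : ℕ∞) f)
    (hRic : ∀ x v, (0 : ℝ) ≤ hess f x v v)
    (x₀ : EuclideanSpace ℝ (Fin N))
    (u : EuclideanSpace ℝ (Fin N) × ℝ → ℝ) (hu : ContDiff ℝ (⊤ : ℕ∞) u)
    (heq : ∀ p : EuclideanSpace ℝ (Fin N) × ℝ, p.2 ≤ 0 → tderiv u p = swlap f u p)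
    (hgrowth : Filter.Tendsto
      (fun p : EuclideanSpace ℝ (Fin N) × ℝ =>
        |u p| / (‖p.1 - x₀‖ ^ ((1 : ℝ) / 2) + |p.2| ^ ((1 : ℝ) / 4)))
      (ancientAtInfty x₀) (𝓝 0)) :
    ∀ p p' : EuclideanSpace ℝ (Fin N) × ℝ, p.2 ≤ 0 → p'.2 ≤ 0 → u p = u p' := by
  have hL : ∀ p : EuclideanSpace ℝ (Fin N) × ℝ, p.2 ≤ 0 → heatL ee tt (fun q => f q.1) u p = 0 :=
    fun p hp => heq_iff hf hu p (heq p hp)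
  have hw : ∀ p : EuclideanSpace ℝ (Fin N) × ℝ, p.2 ≤ 0 → gsq ee u p = 0 := by
    intro p hp
    have hwn : 0 ≤ gsq ee u p := Finset.sum_nonneg fun j _ => mul_self_nonneg _
    set K := 2 * (N : ℝ) + 2 * ‖gradient f x₀‖ + 14 with hK
    have hK0 : 0 < K := by positivity
    have hcutlim : Tendsto (fun R : ℝ => cut x₀ R p) atTop (𝓝 1) := by
      unfold cut
      have h1 : Tendsto (fun R : ℝ => ‖p.1 - x₀‖ ^ 2 / R ^ 2) atTop (𝓝 0) :=
        tendsto_const_nhds.div_atTop (tendsto_pow_atTop two_ne_zero)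
      have h2 : Tendsto (fun R : ℝ => p.2 / R) atTop (𝓝 0) :=
        tendsto_const_nhds.div_atTop tendsto_id
      simpa using (tendsto_const_nhds (x := (1 : ℝ))).sub h1 |>.add h2
    have hbound : ∀ ε : ℝ, 0 < ε → gsq ee u p ≤ 16 * K * ε ^ 2 := by
      intro ε hε
      obtain ⟨R, hR1, hRc, hRB⟩ := ((eventually_ge_atTop (1 : ℝ)).and
        ((hcutlim.eventually (lt_mem_nhds (show (1 / 2 : ℝ) < 1 by norm_num))).and
          (growth_bound x₀ hu hgrowth ε hε))).exists
      have hest := local_est hf hRic x₀ hu hL R hR1 _ hRB p hp (by linarith)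
      have hR0 : R ≠ 0 := by linarith
      have e1 : (2 * (N : ℝ) + 2 * ‖gradient f x₀‖ + 14) / R * (4 * ε ^ 2 * R) = 4 * K * ε ^ 2 := by
        rw [← hK]; field_simp
      rw [e1] at hest
      have e2 : (1 / 4 : ℝ) ≤ cut x₀ R p * cut x₀ R p := by nlinarith
      have e3 := mul_le_mul_of_nonneg_right e2 hwn
      linarith
    by_contra hne
    have hpos : 0 < gsq ee u p := lt_of_le_of_ne hwn (Ne.symm hne)
    have h1 := hbound (Real.sqrt (gsq ee u p / (32 * K))) (Real.sqrt_pos.2 (by positivity))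
    rw [Real.sq_sqrt (by positivity)] at h1
    have h2 : 16 * K * (gsq ee u p / (32 * K)) = gsq ee u p / 2 := by field_simp; norm_num
    linarith
  have hi : ∀ p : EuclideanSpace ℝ (Fin N) × ℝ, p.2 ≤ 0 → ∀ i, dd (ee i) u p = 0 := by
    intro p hp i
    have h1 := (Finset.sum_eq_zero_iff_of_nonneg
      (fun j _ => mul_self_nonneg (dd (ee j) u p))).1 (hw p hp) i (Finset.mem_univ i)
    exact mul_self_eq_zero.1 h1
  have ht : ∀ p : EuclideanSpace ℝ (Fin N) × ℝ, p.2 ≤ 0 → dd tt u p = 0 := by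
    intro p hp
    have h1 := hL p hp
    have h2 : ∀ i, dd (ee i) (dd (ee i) u) p = 0 := fun i =>
      dd_zero_of_line (dd_contDiff hu _) _ _ (fun s => hi _ (by simpa [ee] using hp) i)
    unfold heatL at h1
    simpa [h2, hi p hp] using h1
  have hfd : ∀ p : EuclideanSpace ℝ (Fin N) × ℝ, p.2 ≤ 0 → fderiv ℝ u p = 0 := by
    intro p hp
    refine ContinuousLinearMap.ext fun w => ?_
    have h1 : w = (∑ i, w.1 i • ee i) + w.2 • tt := by
      refine Prod.ext ?_ ?_
      · simp only [Prod.fst_add, Prod.fst_sum, Prod.smul_fst, ee, tt, smul_zero, add_zero]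
        exact sum_single w.1
      · simp [Prod.snd_sum, ee, tt]
    have h2 := dd_lin Finset.univ (fun i => w.1 i) ee u p
    have h3 := ht p hp
    simp only [hi p hp, mul_zero, Finset.sum_const_zero] at h2
    unfold dd at h2 h3
    rw [h1, map_add, h2, map_smul, h3]
    simp
  intro p p' hp hp'
  have hconv : Convex ℝ {q : EuclideanSpace ℝ (Fin N) × ℝ | q.2 ≤ 0} :=
    (convex_Iic (0 : ℝ)).linear_preimage (LinearMap.snd ℝ (EuclideanSpace ℝ (Fin N)) ℝ)
  have h1 := hconv.norm_image_sub_le_of_norm_hasFDerivWithin_le (f := u) (f' := fun q => fderiv ℝ u q)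
    (C := 0) (fun q _ => (sm_diff hu q).hasFDerivAt.hasFDerivWithinAt)
    (fun q hq => by rw [hfd q hq]; simp) hp' hp
  rw [zero_mul, norm_le_zero_iff, sub_eq_zero] at h1
  exact h1
end
end

section
/- Fix t₀ ∈ ℝ, T > 0, R > 0 and τ ∈ (t₀−T, t₀]. Then there exists a smooth function ψ : ℝ × ℝ → ℝ, written ψ = ψ(r,t), such that: (i) 0 ≤ ψ ≤ 1 everywhere, ψ(r,t) = 1 for (r,t) ∈ [0, R/2] × [τ, t₀], ψ(r,t) = 0 whenever r ≥ R, and ψ(r, t₀−T) = 0 for all r ≥ 0; (ii) ∂ψ/∂r ≤ 0 for r ≥ 0 and ∂ψ/∂r = 0 for 0 ≤ r ≤ R/2; (iii) for every a ∈ (0,1) there is a constant C_a, independent of R, T, τ, t₀, such that |∂ψ/∂r| ≤ (C_a/R)·ψ^a and |∂²ψ/∂r²| ≤ (C_a/R²)·ψ^a on [0,∞) × [t₀−T, t₀]; (iv) there is an absolute constant C > 0 such that |∂ψ/∂t| ≤ C·ψ^{1/2}/(τ − (t₀−T)) on [0,∞) × [t₀−T, t₀]. -/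
open Real Set Filter
open scoped Topology

noncomputable section

namespace CutoffAux

open Polynomial in
/-- Polynomial multiples (in `1/x`) of `exp (-1/x)` are dominated by any power `a < 1` of the
smooth transition. -/
lemma poly_bound (p : ℝ[X]) (a : ℝ) (ha : a ∈ Set.Ioo (0 : ℝ) 1) :
    ∃ C : ℝ, 0 ≤ C ∧ ∀ x ∈ Set.Icc (0 : ℝ) 1,
      |p.eval x⁻¹ * expNegInvGlue x| ≤ C * smoothTransition x ^ a := by
  obtain ⟨ha0, ha1⟩ := ha
  have hb : 0 < 1 - a := by linarith
  let q : ℝ[X] := p.comp (Polynomial.C (1 - a)⁻¹ * X)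
  have hc : Continuous (fun x : ℝ => q.eval (x / (1 - a))⁻¹ * expNegInvGlue (x / (1 - a))) :=
    (expNegInvGlue.continuous_polynomial_eval_inv_mul q).comp (continuous_id.div_const _)
  obtain ⟨K, hK⟩ := (isCompact_Icc (a := (0 : ℝ)) (b := 1)).exists_bound_of_continuousOn
    hc.continuousOn
  have hK0 : 0 ≤ K := (norm_nonneg _).trans (hK 0 (by simp))
  refine ⟨K * 2 ^ a, by positivity, fun x hx => ?_⟩
  rcases hx.1.eq_or_lt with h0 | h0
  · subst h0
    simp
    positivity
  have hE : expNegInvGlue x = expNegInvGlue (x / (1 - a)) * expNegInvGlue x ^ a := by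
    have h1 : 0 < x / (1 - a) := by positivity
    simp only [expNegInvGlue, not_le.2 h0, not_le.2 h1, if_false]
    rw [← Real.exp_mul, ← Real.exp_add]
    congr 1
    field_simp
    ring
  have hq : q.eval (x / (1 - a))⁻¹ = p.eval x⁻¹ := by
    simp only [q, Polynomial.eval_comp, Polynomial.eval_mul, Polynomial.eval_C, Polynomial.eval_X]
    congr 1
    field_simp
  have hle1 : ∀ y, expNegInvGlue y ≤ 1 := by
    intro y
    unfold expNegInvGlue
    split_ifs with h
    · norm_num
    · rw [Real.exp_le_one_iff]
      have : 0 < y := not_le.1 h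
      simp [this.le]
  have hES : expNegInvGlue x ≤ 2 * smoothTransition x := by
    unfold smoothTransition
    have hd := smoothTransition.pos_denom x
    rw [← mul_div_assoc, le_div_iff₀ hd]
    have := hle1 x
    have := hle1 (1 - x)
    nlinarith [expNegInvGlue.nonneg x]
  have hpow : expNegInvGlue x ^ a ≤ 2 ^ a * smoothTransition x ^ a := by
    rw [← Real.mul_rpow (by norm_num) (smoothTransition.nonneg x)]
    exact Real.rpow_le_rpow (expNegInvGlue.nonneg x) hES ha0.le
  have hKx := hK x hx
  rw [hq, Real.norm_eq_abs] at hKx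
  have hEa : 0 ≤ expNegInvGlue x ^ a := Real.rpow_nonneg (expNegInvGlue.nonneg x) _
  calc |p.eval x⁻¹ * expNegInvGlue x|
      = |p.eval x⁻¹ * expNegInvGlue (x / (1 - a))| * expNegInvGlue x ^ a := by
        conv_lhs => rw [hE]
        rw [← mul_assoc, abs_mul, abs_of_nonneg hEa]
    _ ≤ K * (2 ^ a * smoothTransition x ^ a) := by gcongr
    _ = _ := by ring

lemma deriv_zero_of_one_le {x : ℝ} (hx : 1 ≤ x) : deriv smoothTransition x = 0 := by
  apply IsLocalMax.deriv_eq_zero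
  refine Filter.Eventually.of_forall fun y => ?_
  rw [smoothTransition.one_of_one_le hx]
  exact smoothTransition.le_one y

lemma deriv_zero_of_nonpos {x : ℝ} (hx : x ≤ 0) : deriv smoothTransition x = 0 := by
  apply IsLocalMin.deriv_eq_zero
  refine Filter.Eventually.of_forall fun y => ?_
  rw [smoothTransition.zero_of_nonpos hx]
  exact smoothTransition.nonneg y

lemma deriv2_zero_of_not_mem {x : ℝ} (hx : x ∉ Set.Icc (0 : ℝ) 1) :
    deriv (deriv smoothTransition) x = 0 := by
  have h : deriv smoothTransition =ᶠ[𝓝 x] fun _ => (0 : ℝ) := by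
    rcases lt_or_ge x 0 with h | h
    · filter_upwards [gt_mem_nhds h] with y hy using deriv_zero_of_nonpos hy.le
    · have h1 : 1 < x := by
        by_contra h1
        exact hx ⟨h, not_lt.1 h1⟩
      filter_upwards [lt_mem_nhds h1] with y hy using deriv_zero_of_one_le hy.le
  rw [h.deriv_eq]
  simp

lemma contDiff_deriv_of {f : ℝ → ℝ} (hf : ContDiff ℝ (⊤ : ℕ∞) f) :
    ContDiff ℝ (⊤ : ℕ∞) (deriv f) :=
  (contDiff_infty_iff_deriv.1 hf).2

lemma transition_bound (a : ℝ) (ha : a ∈ Set.Ioo (0 : ℝ) 1) :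
    ∃ C : ℝ, 0 < C ∧ ∀ x : ℝ, |deriv smoothTransition x| ≤ C * smoothTransition x ^ a ∧
      |deriv (deriv smoothTransition) x| ≤ C * smoothTransition x ^ a := by
  let h : ℝ → ℝ := fun x => (expNegInvGlue x + expNegInvGlue (1 - x))⁻¹
  have hh : ContDiff ℝ (⊤ : ℕ∞) h := by
    refine ContDiff.inv ?_ fun x => (smoothTransition.pos_denom x).ne'
    exact expNegInvGlue.contDiff.add
      (expNegInvGlue.contDiff.comp (contDiff_const.sub contDiff_id))
  have hh1 := contDiff_deriv_of hh
  have hh2 := contDiff_deriv_of hh1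
  have hd0 : ∀ x, HasDerivAt h (deriv h x) x := fun x =>
    (hh.differentiable (by simp) x).hasDerivAt
  have hd1 : ∀ x, HasDerivAt (deriv h) (deriv (deriv h) x) x := fun x =>
    (hh1.differentiable (by simp) x).hasDerivAt
  obtain ⟨p1, hp1⟩ : ∃ p : Polynomial ℝ, ∀ x,
      HasDerivAt expNegInvGlue (p.eval x⁻¹ * expNegInvGlue x) x :=
    ⟨_, fun x => by
      have := expNegInvGlue.hasDerivAt_polynomial_eval_inv_mul 1 x
      simp only [Polynomial.eval_one, one_mul] at this
      exact this⟩
  obtain ⟨p2, hp2⟩ : ∃ p : Polynomial ℝ, ∀ x,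
      HasDerivAt (fun x => p1.eval x⁻¹ * expNegInvGlue x) (p.eval x⁻¹ * expNegInvGlue x) x :=
    ⟨_, fun x => expNegInvGlue.hasDerivAt_polynomial_eval_inv_mul p1 x⟩
  have hS : smoothTransition = fun x => expNegInvGlue x * h x := by
    ext x
    simp [smoothTransition, h, div_eq_mul_inv]
  have hS1 : deriv smoothTransition = fun x =>
      (p1.eval x⁻¹ * expNegInvGlue x) * h x + expNegInvGlue x * deriv h x := by
    ext x
    rw [hS]
    exact ((hp1 x).mul (hd0 x)).deriv
  have hS2 : ∀ x, deriv (deriv smoothTransition) x =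
      ((p2.eval x⁻¹ * expNegInvGlue x) * h x + (p1.eval x⁻¹ * expNegInvGlue x) * deriv h x) +
      ((p1.eval x⁻¹ * expNegInvGlue x) * deriv h x + expNegInvGlue x * deriv (deriv h) x) := by
    intro x
    rw [hS1]
    exact (((hp2 x).mul (hd0 x)).add ((hp1 x).mul (hd1 x))).deriv
  have bd : ∀ f : ℝ → ℝ, ContDiff ℝ (⊤ : ℕ∞) f → ∃ K, 0 ≤ K ∧ ∀ x ∈ Set.Icc (0 : ℝ) 1, |f x| ≤ K := by
    intro f hf
    obtain ⟨K, hK⟩ := (isCompact_Icc (a := (0 : ℝ)) (b := 1)).exists_bound_of_continuousOn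
      hf.continuous.continuousOn
    exact ⟨K, (norm_nonneg _).trans (hK 0 (by simp)), hK⟩
  obtain ⟨K0, hK0, hK0'⟩ := bd _ hh
  obtain ⟨K1, hK1, hK1'⟩ := bd _ hh1
  obtain ⟨K2, hK2, hK2'⟩ := bd _ hh2
  obtain ⟨C0, hC0, hC0'⟩ := poly_bound 1 a ha
  obtain ⟨C1, hC1, hC1'⟩ := poly_bound p1 a ha
  obtain ⟨C2, hC2, hC2'⟩ := poly_bound p2 a ha
  simp only [Polynomial.eval_one, one_mul] at hC0'
  have mb : ∀ {u v c k s : ℝ}, |u| ≤ c * s → |v| ≤ k → 0 ≤ c * s → |u * v| ≤ c * k * s := by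
    intro u v c k s h1 h2 h3
    rw [abs_mul]
    calc |u| * |v| ≤ (c * s) * k := by gcongr
      _ = _ := by ring
  refine ⟨(C1 * K0 + C0 * K1) + (C2 * K0 + C1 * K1 + (C1 * K1 + C0 * K2)) + 1, by positivity,
    fun x => ?_⟩
  have hs : 0 ≤ smoothTransition x ^ a := Real.rpow_nonneg (smoothTransition.nonneg x) _
  by_cases hx : x ∈ Set.Icc (0 : ℝ) 1
  · have e1 := mb (hC1' x hx) (hK0' x hx) (by positivity)
    have e2 := mb (hC0' x hx) (hK1' x hx) (by positivity)
    have e3 := mb (hC2' x hx) (hK0' x hx) (by positivity)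
    have e4 := mb (hC1' x hx) (hK1' x hx) (by positivity)
    have e5 := mb (hC0' x hx) (hK2' x hx) (by positivity)
    constructor
    · rw [hS1]
      refine ((abs_add_le _ _).trans (add_le_add e1 e2)).trans ?_
      rw [← add_mul]
      refine mul_le_mul_of_nonneg_right ?_ hs
      have : 0 ≤ (C2 * K0 + C1 * K1 + (C1 * K1 + C0 * K2)) := by positivity
      linarith
    · rw [hS2]
      refine ((abs_add_le _ _).trans (add_le_add ((abs_add_le _ _).trans (add_le_add e3 e4))
        ((abs_add_le _ _).trans (add_le_add e4 e5)))).trans ?_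
      rw [← add_mul, ← add_mul, ← add_mul]
      refine mul_le_mul_of_nonneg_right ?_ hs
      have : 0 ≤ (C1 * K0 + C0 * K1) := by positivity
      linarith
  · have h1 : deriv smoothTransition x = 0 := by
      rcases le_or_gt x 0 with h | h
      · exact deriv_zero_of_nonpos h
      · apply deriv_zero_of_one_le
        by_contra h1
        exact hx ⟨h.le, (not_le.1 h1).le⟩
    rw [h1, deriv2_zero_of_not_mem hx, abs_zero]
    exact ⟨by positivity, by positivity⟩

lemma le_rpow_self {s a : ℝ} (h0 : 0 ≤ s) (h1 : s ≤ 1) (ha : a ∈ Set.Ioo (0 : ℝ) 1) :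
    s ≤ s ^ a := by
  rcases h0.eq_or_lt with h | h
  · rw [← h, Real.zero_rpow ha.1.ne']
  · simpa using Real.rpow_le_rpow_of_exponent_ge h h1 ha.2.le

end CutoffAux

/-- **Lemma 2.2 (Souplet–Zhang cut-off).** Existence of a smooth space-time cut-off function
`ψ(r,t)` adapted to the cylinder `[0,R] × [t₀−T, t₀]`, with bounds on its derivatives whose
constants are independent of `R`, `T`, `τ` and `t₀`. -/
theorem cutoff_function_exists :
    ∃ (C : ℝ) (Ca : ℝ → ℝ), 0 < C ∧ (∀ a ∈ Set.Ioo (0 : ℝ) 1, 0 < Ca a) ∧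
      ∀ (t₀ T R τ : ℝ), 0 < T → 0 < R → τ ∈ Set.Ioc (t₀ - T) t₀ →
        ∃ ψ : ℝ × ℝ → ℝ, ContDiff ℝ (⊤ : ℕ∞) ψ ∧
          -- (i)
          (∀ p, 0 ≤ ψ p ∧ ψ p ≤ 1) ∧
          (∀ r ∈ Set.Icc (0 : ℝ) (R / 2), ∀ t ∈ Set.Icc τ t₀, ψ (r, t) = 1) ∧
          (∀ r t : ℝ, R ≤ r → ψ (r, t) = 0) ∧
          (∀ r : ℝ, 0 ≤ r → ψ (r, t₀ - T) = 0) ∧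
          -- (ii)
          (∀ r t : ℝ, 0 ≤ r → deriv (fun s => ψ (s, t)) r ≤ 0) ∧
          (∀ r t : ℝ, 0 ≤ r → r ≤ R / 2 → deriv (fun s => ψ (s, t)) r = 0) ∧
          -- (iii)
          (∀ a ∈ Set.Ioo (0 : ℝ) 1, ∀ r : ℝ, 0 ≤ r → ∀ t ∈ Set.Icc (t₀ - T) t₀,
            |deriv (fun s => ψ (s, t)) r| ≤ Ca a / R * ψ (r, t) ^ a ∧
            |deriv (deriv (fun s => ψ (s, t))) r| ≤ Ca a / R ^ 2 * ψ (r, t) ^ a) ∧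
          -- (iv)
          (∀ r : ℝ, 0 ≤ r → ∀ t ∈ Set.Icc (t₀ - T) t₀,
            |deriv (fun s => ψ (r, s)) t| ≤
              C * ψ (r, t) ^ ((1 : ℝ) / 2) / (τ - (t₀ - T))) := by
  have key : ∀ a : ℝ, ∃ C : ℝ, 0 < C ∧ (a ∈ Set.Ioo (0 : ℝ) 1 → ∀ x : ℝ,
      |deriv smoothTransition x| ≤ C * smoothTransition x ^ a ∧
      |deriv (deriv smoothTransition) x| ≤ C * smoothTransition x ^ a) := by
    intro a
    by_cases ha : a ∈ Set.Ioo (0 : ℝ) 1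
    · obtain ⟨C, h, h'⟩ := CutoffAux.transition_bound a ha
      exact ⟨C, h, fun _ => h'⟩
    · exact ⟨1, one_pos, fun h => absurd h ha⟩
  choose D hD hDb using key
  refine ⟨D (1 / 2), fun a => 4 * D a, hD _, fun a _ => by have := hD a; positivity, ?_⟩
  intro t₀ T R τ hT hR hτ
  have hL : 0 < τ - (t₀ - T) := sub_pos.2 hτ.1
  set L := τ - (t₀ - T) with hLdef
  let u : ℝ → ℝ := fun r => 2 - 2 / R * r
  let v : ℝ → ℝ := fun t => (t - (t₀ - T)) / L
  have hSd : ∀ x, HasDerivAt smoothTransition (deriv smoothTransition x) x := fun x =>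
    ((smoothTransition.contDiff (n := ⊤)).differentiable (by simp) x).hasDerivAt
  have hSd2 : ∀ x, HasDerivAt (deriv smoothTransition) (deriv (deriv smoothTransition) x) x :=
    fun x => ((CutoffAux.contDiff_deriv_of (smoothTransition.contDiff (n := ⊤))).differentiable
      (by simp) x).hasDerivAt
  have hu : ∀ r, HasDerivAt u (-(2 / R)) r := fun r => by
    simpa using ((hasDerivAt_id r).const_mul (2 / R)).const_sub 2
  have hv : ∀ t, HasDerivAt v (1 / L) t := fun t =>
    ((hasDerivAt_id t).sub_const _).div_const L
  have h1 : ∀ t, deriv (fun s => smoothTransition (u s) * smoothTransition (v t)) =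
      fun r => deriv smoothTransition (u r) * (-(2 / R)) * smoothTransition (v t) := by
    intro t
    ext r
    exact (((hSd (u r)).comp r (hu r)).mul_const _).deriv
  have h2 : ∀ t r, deriv (deriv (fun s => smoothTransition (u s) * smoothTransition (v t))) r =
      deriv (deriv smoothTransition) (u r) * (-(2 / R)) * (-(2 / R)) * smoothTransition (v t) := by
    intro t r
    rw [h1]
    exact ((((hSd2 (u r)).comp r (hu r)).mul_const _).mul_const _).deriv
  have h3 : ∀ t r, deriv (fun s => smoothTransition (u r) * smoothTransition (v s)) t =
      smoothTransition (u r) * (deriv smoothTransition (v t) * (1 / L)) := by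
    intro t r
    exact (((hSd (v t)).comp t (hv t)).const_mul _).deriv
  have hn := smoothTransition.nonneg
  have hl := smoothTransition.le_one
  refine ⟨fun p => smoothTransition (u p.1) * smoothTransition (v p.2), ?_, ?_, ?_, ?_, ?_, ?_, ?_,
    ?_, ?_⟩
  · have hcu : ContDiff ℝ (⊤ : ℕ∞) (fun p : ℝ × ℝ => u p.1) :=
      contDiff_const.sub (contDiff_const.mul contDiff_fst)
    have hcv : ContDiff ℝ (⊤ : ℕ∞) (fun p : ℝ × ℝ => v p.2) :=
      (contDiff_snd.sub contDiff_const).div_const L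
    exact (smoothTransition.contDiff.comp hcu).mul (smoothTransition.contDiff.comp hcv)
  · exact fun p => ⟨mul_nonneg (hn _) (hn _), mul_le_one₀ (hl _) (hn _) (hl _)⟩
  · intro r hr t ht
    have hu1 : 1 ≤ u r := by
      have : 2 / R * r ≤ 1 := by
        rw [div_mul_eq_mul_div, div_le_one hR]
        linarith [hr.2]
      simp only [u]
      linarith
    have hv1 : 1 ≤ v t := by
      simp only [v]
      rw [one_le_div hL]
      linarith [ht.1]
    simp only [smoothTransition.one_of_one_le hu1, smoothTransition.one_of_one_le hv1, mul_one]
  · intro r t hr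
    have hu0 : u r ≤ 0 := by
      have : 2 ≤ 2 / R * r := by
        rw [div_mul_eq_mul_div, le_div_iff₀ hR]
        linarith
      simp only [u]
      linarith
    simp only [smoothTransition.zero_of_nonpos hu0, zero_mul]
  · intro r _
    simp [v]
  · intro r t _
    simp only [h1]
    have hm : 0 ≤ deriv smoothTransition (u r) := smoothTransition.monotone.deriv_nonneg
    have : 0 ≤ deriv smoothTransition (u r) * (2 / R) * smoothTransition (v t) :=
      mul_nonneg (by positivity) (hn _)
    linarith
  · intro r t _ hr
    simp only [h1]
    have hu1 : 1 ≤ u r := by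
      have : 2 / R * r ≤ 1 := by
        rw [div_mul_eq_mul_div, div_le_one hR]
        linarith
      simp only [u]
      linarith
    rw [CutoffAux.deriv_zero_of_one_le hu1]
    ring
  · intro a ha r _ t _
    obtain ⟨b1, b2⟩ := hDb a ha (u r)
    have b3 := CutoffAux.le_rpow_self (hn (v t)) (hl (v t)) ha
    have hD' := hD a
    have hua : 0 ≤ smoothTransition (u r) ^ a := Real.rpow_nonneg (hn _) _
    have hva : 0 ≤ smoothTransition (v t) ^ a := Real.rpow_nonneg (hn _) _
    have hnv := hn (v t)
    simp only [h2]
    simp only [h1]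
    rw [Real.mul_rpow (hn _) (hn _)]
    constructor
    · rw [abs_mul, abs_mul, abs_neg, abs_of_pos (by positivity : 0 < 2 / R),
        abs_of_nonneg (hn (v t))]
      calc _ ≤ (D a * smoothTransition (u r) ^ a) * (2 / R) * smoothTransition (v t) ^ a := by
            gcongr
        _ = 2 * D a / R * (smoothTransition (u r) ^ a * smoothTransition (v t) ^ a) := by ring
        _ ≤ _ := by
            gcongr
            norm_num
    · rw [abs_mul, abs_mul, abs_mul, abs_neg, abs_of_pos (by positivity : 0 < 2 / R),
        abs_of_nonneg (hn (v t))]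
      calc _ ≤ (D a * smoothTransition (u r) ^ a) * (2 / R) * (2 / R) *
              smoothTransition (v t) ^ a := by gcongr
        _ = _ := by
            field_simp
            ring
  · intro r _ t _
    have ha : (1 / 2 : ℝ) ∈ Set.Ioo (0 : ℝ) 1 := by norm_num
    obtain ⟨b1, -⟩ := hDb _ ha (v t)
    have b3 := CutoffAux.le_rpow_self (hn (u r)) (hl (u r)) ha
    have hua : 0 ≤ smoothTransition (u r) ^ (1 / 2 : ℝ) := Real.rpow_nonneg (hn _) _
    simp only [h3]
    rw [Real.mul_rpow (hn _) (hn _), abs_mul, abs_mul, abs_of_pos (by positivity : 0 < 1 / L),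
      abs_of_nonneg (hn (u r))]
    calc _ ≤ smoothTransition (u r) ^ (1 / 2 : ℝ) *
          ((D (1 / 2) * smoothTransition (v t) ^ (1 / 2 : ℝ)) * (1 / L)) := by gcongr
      _ = _ := by ring
end
end

section
/- Let α > 1 be real, let q ≤ 0 be real, and let u : ℝ → ℝ be differentiable on (−∞, 0] with u(t) > 0 and u'(t) = q·u(t)^α for all t ≤ 0. Then q = 0 and u is constant on (−∞, 0]. -/
open Real Set

theorem const_of_deriv_zero_Iic (g : ℝ → ℝ)
    (hg : ∀ t ≤ (0 : ℝ), HasDerivWithinAt g 0 (Set.Iic (0 : ℝ)) t) :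
    ∀ s ≤ (0 : ℝ), ∀ t ≤ (0 : ℝ), g s = g t := by
  intro s hs t ht
  have h := Convex.norm_image_sub_le_of_norm_hasDerivWithin_le (C := 0) (f := g)
    (f' := fun _ => 0) (s := Set.Iic (0 : ℝ)) (x := t) (y := s)
    (fun x hx => hg x hx) (fun x _ => by simp) (convex_Iic 0) ht hs
  rw [zero_mul] at h
  exact sub_eq_zero.mp (norm_le_zero_iff.mp h)

/-- **Key ODE step in the proof of Theorem 1.2(1):** if `α > 1`, `q ≤ 0`, and `u > 0` solves
`u' = q uᵅ` on `(−∞, 0]`, then `q = 0` and `u` is constant on `(−∞, 0]`. -/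
theorem ode_liouville_step (α q : ℝ) (hα : 1 < α) (hq : q ≤ 0) (u : ℝ → ℝ)
    (hpos : ∀ t ≤ (0 : ℝ), 0 < u t)
    (hderiv : ∀ t ≤ (0 : ℝ), HasDerivWithinAt u (q * u t ^ α) (Set.Iic (0 : ℝ)) t) :
    q = 0 ∧ ∀ s ≤ (0 : ℝ), ∀ t ≤ (0 : ℝ), u s = u t := by
  have hq0 : q = 0 := by
    by_contra hne
    have hqneg : q < 0 := lt_of_le_of_ne hq hne
    have hc : 0 < (1 - α) * q := mul_pos_of_neg_of_neg (by linarith) hqneg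
    have hg := const_of_deriv_zero_Iic (fun t => u t ^ (1 - α) - (1 - α) * q * t) (by
      intro t ht
      have h1 := (hderiv t ht).rpow_const (p := 1 - α) (Or.inl (hpos t ht).ne')
      have h2 := (hasDerivWithinAt_id t (Set.Iic (0 : ℝ))).const_mul ((1 - α) * q)
      refine (h1.sub h2).congr_deriv ?_
      have h3 : u t ^ α * u t ^ (1 - α - 1) = 1 := by
        rw [← Real.rpow_add (hpos t ht)]
        simp
      linear_combination ((1 - α) * q) * h3)
    have hA : 0 < u 0 ^ (1 - α) := Real.rpow_pos_of_pos (hpos 0 le_rfl) _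
    have hT : -(u 0 ^ (1 - α) / ((1 - α) * q)) ≤ 0 := by
      have := div_pos hA hc
      linarith
    have h := hg _ hT 0 le_rfl
    have hB := Real.rpow_pos_of_pos (hpos _ hT) (1 - α)
    have hm : (1 - α) * q * (u 0 ^ (1 - α) / ((1 - α) * q)) = u 0 ^ (1 - α) :=
      mul_div_cancel₀ _ hc.ne'
    simp only [mul_neg, hm, mul_zero] at h
    linarith
  refine ⟨hq0, const_of_deriv_zero_Iic u ?_⟩
  intro t ht
  simpa [hq0] using hderiv t ht
end

section
/- Let N ≥ 2, K ≥ 0, and let f : ℝ^N → ℝ be smooth with ∇²f(v,v) ≥ −(N−1)K|v|² for all vectors v. Fix x₀ ∈ ℝ^N and set μ := max_{|x−x₀|=1} ( (N−1) − ⟨∇f(x), x−x₀⟩ ). Then for every x ∈ ℝ^N with r := |x−x₀| ≥ 1: (N−1)/r − ⟨∇f(x), (x−x₀)/r⟩ ≤ μ + (N−1)·K·(r−1). -/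
open Real Set Metric Filter
open scoped RealInnerProductSpace Topology

noncomputable section

/-- **Weighted Laplacian comparison, Euclidean case:** with
`μ = max_{|x−x₀|=1} ((N−1) − ⟨∇f(x), x−x₀⟩)` and `Ric_f = ∇²f ≥ −(N−1)K`, for `r = |x−x₀| ≥ 1`
one has `Δ_f r = (N−1)/r − ⟨∇f(x), (x−x₀)/r⟩ ≤ μ + (N−1)K(r−1)`. -/
theorem weighted_laplacian_comparison (N : ℕ) (hN : 2 ≤ N) (K : ℝ) (hK : 0 ≤ K)
    (f : EuclideanSpace ℝ (Fin N) → ℝ) (hf : ContDiff ℝ (⊤ : ℕ∞) f)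
    (hRic : ∀ x v, -(((N : ℝ) - 1) * K * ‖v‖ ^ 2) ≤ hess f x v v)
    (x₀ x : EuclideanSpace ℝ (Fin N)) (hx : 1 ≤ ‖x - x₀‖) :
    ((N : ℝ) - 1) / ‖x - x₀‖ - ⟪gradient f x, (‖x - x₀‖)⁻¹ • (x - x₀)⟫ ≤
      muConst f x₀ + ((N : ℝ) - 1) * K * (‖x - x₀‖ - 1) := by
  have hg : ContDiff ℝ 1 (gradient f) := by
    have h1 : ContDiff ℝ 1 (fderiv ℝ f) := (contDiff_infty.mp hf 2).fderiv_right (by norm_num)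
    exact (InnerProductSpace.toDual ℝ (EuclideanSpace ℝ (Fin N))).symm.contDiff.comp h1
  have hgd : Differentiable ℝ (gradient f) := hg.differentiable (by norm_num)
  set r := ‖x - x₀‖ with hr
  have hr0 : 0 < r := by linarith
  set e := r⁻¹ • (x - x₀) with he
  have hen : ‖e‖ = 1 := by
    rw [he, norm_smul, norm_inv, Real.norm_of_nonneg hr0.le, ← hr]
    field_simp
  have hxe : x₀ + r • e = x := by
    rw [he, smul_smul, mul_inv_cancel₀ hr0.ne', one_smul]
    abel
  have hd : ∀ t : ℝ, HasDerivAt (fun t : ℝ => ⟪gradient f (x₀ + t • e), e⟫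
      + ((N : ℝ) - 1) * K * t) (hess f (x₀ + t • e) e e + ((N : ℝ) - 1) * K) t := by
    intro t
    have h1 : HasDerivAt (fun t : ℝ => x₀ + t • e) e t := by
      simpa using ((hasDerivAt_id t).smul_const e).const_add x₀
    have h2 := (hgd (x₀ + t • e)).hasFDerivAt.comp_hasDerivAt t h1
    have h3 := h2.inner ℝ (hasDerivAt_const t e)
    have h4 := h3.add ((hasDerivAt_id t).const_mul (((N : ℝ) - 1) * K))
    refine HasDerivAt.congr_deriv (f' := _) h4 ?_
    simp [hess]
  have hmono : Monotone (fun t : ℝ => ⟪gradient f (x₀ + t • e), e⟫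
      + ((N : ℝ) - 1) * K * t) := by
    apply monotone_of_deriv_nonneg (fun t => (hd t).differentiableAt)
    intro t
    rw [(hd t).deriv]
    have := hRic (x₀ + t • e) e
    rw [hen] at this
    linarith
  have hm := hmono hx
  simp only [hxe, one_smul, mul_one] at hm
  have hmu : ((N : ℝ) - 1) - ⟪gradient f (x₀ + e), e⟫ ≤ muConst f x₀ := by
    apply le_csSup
    · apply (IsCompact.image (isCompact_sphere x₀ 1) _).bddAbove
      have := hg.continuous
      fun_prop
    · exact ⟨x₀ + e, by simp [hen], by simp⟩
  have hN1 : (0 : ℝ) ≤ (N : ℝ) - 1 := by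
    have : (2 : ℝ) ≤ N := by exact_mod_cast hN
    linarith
  have hdiv : ((N : ℝ) - 1) / r ≤ (N : ℝ) - 1 := div_le_self hN1 hx
  linarith
end
end
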